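/- arXiv:math/0511104 — 2 statements merged into one kernel-verified Lean document; each statement's English description precedes it below -/
import Mathlib

section
/- For all δ ≥ 0, C ≥ 0 and D > 0 there exists Δ ≥ 0 such that the following holds. If (X,d) is a δ-hyperbolic geodesic metric space and 𝓗 is a collection of C-quasiconvex, D-separated subsets of X, then the electric pseudometric space (X,d_e) obtained by electrocuting the elements of 𝓗 is Δ-hyperbolic, i.e. the Gromov four-point inequality (a,b)_w ≥ min((a,c)_w, (c,b)_w) − Δ holds for all a,b,c,w ∈ X, where (a,b)_w = ½(d_e(a,w)+d_e(b,w)−d_e(a,b)). -/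
open Metric Set

/-- `f` is a geodesic from `x` to `y`, parametrized by arc length on `[0, dist x y]`. -/
def IsGeodesicFrom {X : Type*} [MetricSpace X] (f : ℝ → X) (x y : X) : Prop :=
  f 0 = x ∧ f (dist x y) = y ∧
    ∀ s ∈ Set.Icc (0 : ℝ) (dist x y), ∀ t ∈ Set.Icc (0 : ℝ) (dist x y),
      dist (f s) (f t) = |s - t|

/-- `X` is a geodesic metric space: any two points are joined by a geodesic. -/
def GeodesicSpace (X : Type*) [MetricSpace X] : Prop :=
  ∀ x y : X, ∃ f : ℝ → X, IsGeodesicFrom f x y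

/-- Every geodesic triangle of `X` is `δ`-slim: each side lies in the `δ`-neighborhood
of the union of the other two sides. -/
def GromovHyperbolic (X : Type*) [MetricSpace X] (δ : ℝ) : Prop :=
  ∀ x y z : X, ∀ f g h : ℝ → X,
    IsGeodesicFrom f x y → IsGeodesicFrom g y z → IsGeodesicFrom h x z →
    ∀ s ∈ Set.Icc (0 : ℝ) (dist x y),
      ∃ p ∈ g '' Set.Icc (0 : ℝ) (dist y z) ∪ h '' Set.Icc (0 : ℝ) (dist x z),
        dist (f s) p ≤ δ

/-- `A` is a `C`-quasiconvex subset: every geodesic segment with endpoints in `A`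
lies in the `C`-neighborhood of `A`. -/
def QuasiconvexSet {X : Type*} [MetricSpace X] (C : ℝ) (A : Set X) : Prop :=
  ∀ x ∈ A, ∀ y ∈ A, ∀ f : ℝ → X, IsGeodesicFrom f x y →
    ∀ s ∈ Set.Icc (0 : ℝ) (dist x y), ∃ a ∈ A, dist (f s) a ≤ C

/-- The collection `𝓗` is `D`-separated: distinct members are at distance at least `D`. -/
def SeparatedColl {X : Type*} [MetricSpace X] (D : ℝ) (𝓗 : Set (Set X)) : Prop :=
  ∀ A ∈ 𝓗, ∀ B ∈ 𝓗, A ≠ B → ∀ a ∈ A, ∀ b ∈ B, D ≤ dist a b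

/-- The electric pseudometric obtained by electrocuting the members of `𝓗`:
the infimum of `∑ dist (p i) (q i)` over all chains `x = p 0, q 0, p 1, q 1, …, p n, q n = y`
such that consecutive points `q i`, `p (i+1)` lie in a common member of `𝓗`. -/
noncomputable def elecDist {X : Type*} [MetricSpace X] (𝓗 : Set (Set X)) (x y : X) : ℝ :=
  sInf { r : ℝ | ∃ n : ℕ, ∃ p q : Fin (n + 1) → X,
    p 0 = x ∧ q (Fin.last n) = y ∧
    (∀ i : Fin n, ∃ A ∈ 𝓗, q i.castSucc ∈ A ∧ p i.succ ∈ A) ∧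
    r = ∑ i, dist (p i) (q i) }

/-- `f` is a `(K, ε)`-quasigeodesic on the interval `I` with respect to the
distance function `d`. -/
def IsQuasigeodesicOn {X : Type*} (d : X → X → ℝ) (K ε : ℝ) (I : Set ℝ) (f : ℝ → X) : Prop :=
  ∀ s ∈ I, ∀ t ∈ I,
    (1 / K) * |s - t| - ε ≤ d (f s) (f t) ∧ d (f s) (f t) ≤ K * |s - t| + ε

/-- `f` is without backtracking: for some `ε ≥ 0`, `f` never returns to the
`ε`-neighborhood of a member of `𝓗` after leaving it (the set of times spent in such a
neighborhood is convex). -/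
def NoBacktracking {X : Type*} [MetricSpace X] (𝓗 : Set (Set X)) (I : Set ℝ) (f : ℝ → X) :
    Prop :=
  ∃ ε : ℝ, 0 ≤ ε ∧ ∀ A ∈ 𝓗, ∀ s ∈ I, ∀ t ∈ I, ∀ u ∈ I, s ≤ t → t ≤ u →
    f s ∈ Metric.cthickening ε A → f u ∈ Metric.cthickening ε A →
    f t ∈ Metric.cthickening ε A

/-- `π` is a nearest-point projection of `X` onto `A`. -/
def IsNearestPointProj {X : Type*} [MetricSpace X] (A : Set X) (π : X → X) : Prop :=
  ∀ x : X, π x ∈ A ∧ ∀ a ∈ A, dist x (π x) ≤ dist x a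

/-- The collection `𝓗` is mutually `k`-cobounded: any nearest-point projection of one
member onto another has image of diameter at most `k`. -/
def MutuallyCobounded {X : Type*} [MetricSpace X] (k : ℝ) (𝓗 : Set (Set X)) : Prop :=
  ∀ A ∈ 𝓗, ∀ B ∈ 𝓗, A ≠ B → ∀ π : X → X, IsNearestPointProj A π →
    ∀ b₁ ∈ B, ∀ b₂ ∈ B, dist (π b₁) (π b₂) ≤ k

/-- The intrinsic path (pseudo)distance between `x` and `y` inside the subset `A`:
the infimum of lengths of paths from `x` to `y` staying in `A`. -/
noncomputable def pathDistIn {X : Type*} [MetricSpace X] (A : Set X) (x y : X) : ENNReal :=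
  ⨅ (g : ℝ → X) (_ : g 0 = x) (_ : g 1 = y) (_ : ∀ t ∈ Set.Icc (0 : ℝ) 1, g t ∈ A),
    eVariationOn g (Set.Icc (0 : ℝ) 1)

/-- `[s, u]` is a maximal subsegment of the path `β` (defined on `I`) lying within `A`. -/
def IsMaximalSubsegmentIn {X : Type*} [MetricSpace X] (A : Set X) (I : Set ℝ) (β : ℝ → X)
    (s u : ℝ) : Prop :=
  s ∈ I ∧ u ∈ I ∧ s ≤ u ∧ (∀ t ∈ Set.Icc s u ∩ I, β t ∈ A) ∧
    ∀ s' u', s' ∈ I → u' ∈ I → s' ≤ s → u ≤ u' → (∀ t ∈ Set.Icc s' u' ∩ I, β t ∈ A) →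
      s' = s ∧ u' = u

/-- `βq` is the electro-ambient path associated to `β` (both defined on `I`): it agrees
with `β` away from the maximal subsegments of `β` lying within a member of `𝓗`, and along
each such maximal subsegment it traces a geodesic of `(X, d)` joining its endpoints. -/
def IsElectroAmbientRep {X : Type*} [MetricSpace X] (𝓗 : Set (Set X)) (I : Set ℝ)
    (β βq : ℝ → X) : Prop :=
  (∀ t ∈ I, (¬ ∃ A ∈ 𝓗, ∃ s u, IsMaximalSubsegmentIn A I β s u ∧ t ∈ Set.Icc s u) →
      βq t = β t) ∧
  ∀ A ∈ 𝓗, ∀ s u, IsMaximalSubsegmentIn A I β s u →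
    βq s = β s ∧ βq u = β u ∧
      ∃ g : ℝ → X, IsGeodesicFrom g (β s) (β u) ∧
        βq '' (Set.Icc s u ∩ I) = g '' Set.Icc (0 : ℝ) (dist (β s) (β u))

/-- `γ`, defined on `[0, L]`, is a parametrization by arc length of the path `βq`
defined on `I`. -/
def IsArclengthParamOf {X : Type*} [MetricSpace X] (I : Set ℝ) (βq : ℝ → X) (L : ℝ)
    (γ : ℝ → X) : Prop :=
  ∃ σ : ℝ → ℝ, MonotoneOn σ (Set.Icc 0 L) ∧ σ '' Set.Icc 0 L = I ∧
    (∀ s ∈ Set.Icc (0 : ℝ) L, γ s = βq (σ s)) ∧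
    ∀ s ∈ Set.Icc (0 : ℝ) L, eVariationOn γ (Set.Icc 0 s) = ENNReal.ofReal s

/-- The electric length of the path `f` on `I`: the supremum over finite monotone samplings
of the sums of consecutive electric distances (travel inside members of `𝓗` is free). -/
noncomputable def elecLengthOn {X : Type*} [MetricSpace X] (𝓗 : Set (Set X)) (f : ℝ → X)
    (I : Set ℝ) : ENNReal :=
  ⨆ p : ℕ × { u : ℕ → ℝ // Monotone u ∧ ∀ i, u i ∈ I },
    ∑ i ∈ Finset.range p.1, ENNReal.ofReal (elecDist 𝓗 (f (p.2.1 i)) (f (p.2.1 (i + 1))))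

/-- `γ`, defined on `I` and avoiding `⋃₀ 𝓗`, is an ambient `κ`-quasigeodesic: each of its
subsegments has length at most `κ·L(A) + κ` for any rectifiable competitor path `A` with the
same endpoints avoiding `⋃₀ 𝓗`. -/
def IsAmbientQuasigeodesic {X : Type*} [MetricSpace X] (𝓗 : Set (Set X)) (κ : ℝ)
    (I : Set ℝ) (γ : ℝ → X) : Prop :=
  (∀ t ∈ I, γ t ∉ ⋃₀ 𝓗) ∧
  ∀ a b, a ∈ I → b ∈ I → a ≤ b →
    ∀ A : ℝ → X, A a = γ a → A b = γ b → (∀ t ∈ Set.Icc a b, A t ∉ ⋃₀ 𝓗) →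
      eVariationOn A (Set.Icc a b) ≠ ⊤ →
      eVariationOn γ (Set.Icc a b) ≤
        ENNReal.ofReal κ * eVariationOn A (Set.Icc a b) + ENNReal.ofReal κ

/-- `φ` is a `(K, ε)`-quasi-isometric embedding. -/
def IsQIEmbedding {Y₁ Y₂ : Type*} [MetricSpace Y₁] [MetricSpace Y₂] (K ε : ℝ)
    (φ : Y₁ → Y₂) : Prop :=
  ∀ y₁ y₂ : Y₁,
    (1 / K) * dist y₁ y₂ - ε ≤ dist (φ y₁) (φ y₂) ∧ dist (φ y₁) (φ y₂) ≤ K * dist y₁ y₂ + ε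


/-- `p` lies metrically between `x` and `y`. In a geodesic space this says that `p` lies on some
geodesic from `x` to `y`. -/
def MetricBetween {X : Type*} [MetricSpace X] (x y p : X) : Prop :=
  dist x p + dist p y = dist x y

namespace MetricBetween

variable {X : Type*} [MetricSpace X] {x y p : X}

theorem symm (h : MetricBetween x y p) : MetricBetween y x p := by
  unfold MetricBetween at *
  rw [dist_comm y p, dist_comm p x, dist_comm y x]
  linarith

theorem left (x y : X) : MetricBetween x y x := by
  simp [MetricBetween]

theorem right (x y : X) : MetricBetween x y y := by
  simp [MetricBetween]

theorem eq_of_self (h : MetricBetween x x p) : p = x := by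
  unfold MetricBetween at h
  rw [dist_self, dist_comm p x] at h
  exact (dist_eq_zero.1 (by linarith)).symm

theorem trans_left {u : X} (h : MetricBetween x y p) (hu : MetricBetween p x u) :
    MetricBetween x y u := by
  unfold MetricBetween at *
  have := dist_triangle u p y
  have := dist_triangle x u y
  rw [dist_comm p u, dist_comm u x, dist_comm p x] at hu
  linarith

theorem between_of_halves {u w : X} (h : MetricBetween x y p) (hu : MetricBetween p x u)
    (hw : MetricBetween p y w) : MetricBetween u w p := by
  unfold MetricBetween at *
  have := dist_triangle u p w
  have := dist_triangle4 x u w y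
  rw [dist_comm p u, dist_comm u x, dist_comm p x] at hu
  linarith

end MetricBetween

namespace IsGeodesicFrom

variable {X : Type*} [MetricSpace X] {x y p : X} {f : ℝ → X}

theorem dist_left (hf : IsGeodesicFrom f x y) {s : ℝ} (hs : s ∈ Icc 0 (dist x y)) :
    dist x (f s) = s := by
  have h := hf.2.2 0 ⟨le_rfl, dist_nonneg⟩ s hs
  rw [hf.1, zero_sub, abs_neg, abs_of_nonneg hs.1] at h
  exact h

theorem dist_right (hf : IsGeodesicFrom f x y) {s : ℝ} (hs : s ∈ Icc 0 (dist x y)) :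
    dist (f s) y = dist x y - s := by
  have h := hf.2.2 s hs _ ⟨dist_nonneg, le_rfl⟩
  rw [hf.2.1, abs_sub_comm, abs_of_nonneg (by linarith [hs.2])] at h
  exact h

theorem between (hf : IsGeodesicFrom f x y) {s : ℝ} (hs : s ∈ Icc 0 (dist x y)) :
    MetricBetween x y (f s) := by
  rw [MetricBetween, hf.dist_left hs, hf.dist_right hs]
  ring

end IsGeodesicFrom

theorem MetricBetween.exists_geodesic {X : Type*} [MetricSpace X] (hX : GeodesicSpace X)
    {x y p : X} (h : MetricBetween x y p) :
    ∃ f, IsGeodesicFrom f x y ∧ ∃ s ∈ Icc 0 (dist x y), f s = p := by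
  obtain ⟨f, hf⟩ := hX x p
  obtain ⟨g, hg⟩ := hX p y
  unfold MetricBetween at h
  have hxp : 0 ≤ dist x p := dist_nonneg
  have hpy : 0 ≤ dist p y := dist_nonneg
  set F : ℝ → X := fun t => if t ≤ dist x p then f t else g (t - dist x p)
  have hle : ∀ t, t ≤ dist x p → F t = f t := fun t ht => if_pos ht
  have hgt : ∀ t, ¬ t ≤ dist x p → F t = g (t - dist x p) := fun t ht => if_neg ht
  have hp : F (dist x p) = p := by rw [hle _ le_rfl, hf.2.1]
  have mixed : ∀ s ∈ Icc 0 (dist x y), ∀ t ∈ Icc 0 (dist x y), s ≤ dist x p → ¬ t ≤ dist x p →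
      dist (F s) (F t) = t - s := by
    intro s hs t ht h1 h2
    rw [hle s h1, hgt t h2]
    push Not at h2
    have hs' : s ∈ Icc 0 (dist x p) := ⟨hs.1, h1⟩
    have ht' : t - dist x p ∈ Icc 0 (dist p y) := ⟨by linarith, by linarith [ht.2]⟩
    have e1 := hf.dist_left hs'
    have e2 := hf.dist_right hs'
    have e3 := hg.dist_left ht'
    have e4 := hg.dist_right ht'
    have := dist_triangle (f s) p (g (t - dist x p))
    have := dist_triangle4 x (f s) (g (t - dist x p)) y
    linarith
  refine ⟨F, ⟨?_, ?_, ?_⟩, dist x p, ⟨hxp, by linarith⟩, hp⟩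
  · rw [hle 0 hxp, hf.1]
  · by_cases hy : dist x y ≤ dist x p
    · have : p = y := dist_eq_zero.1 (by linarith)
      subst this
      exact hp
    · rw [hgt _ hy, ← h, add_sub_cancel_left, hg.2.1]
  · intro s hs t ht
    by_cases h1 : s ≤ dist x p <;> by_cases h2 : t ≤ dist x p
    · rw [hle s h1, hle t h2]
      exact hf.2.2 s ⟨hs.1, h1⟩ t ⟨ht.1, h2⟩
    · rw [mixed s hs t ht h1 h2, abs_sub_comm, abs_of_nonneg (by linarith)]
    · rw [dist_comm, mixed t ht s hs h2 h1, abs_of_nonneg (by linarith)]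
    · rw [hgt s h1, hgt t h2]
      push Not at h1 h2
      rw [hg.2.2 _ ⟨by linarith, by linarith [hs.2]⟩ _ ⟨by linarith, by linarith [ht.2]⟩]
      congr 1
      ring

section Slim

variable {X : Type*} [MetricSpace X] {δ : ℝ}

theorem GromovHyperbolic.exists_between (hX : GeodesicSpace X) (hδ : GromovHyperbolic X δ)
    {x y p : X} (h : MetricBetween x y p) (z : X) :
    ∃ q, (MetricBetween x z q ∨ MetricBetween z y q) ∧ dist p q ≤ δ := by
  obtain ⟨f, hf, s, hs, rfl⟩ := h.exists_geodesic hX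
  obtain ⟨g, hg⟩ := hX y z
  obtain ⟨k, hk⟩ := hX x z
  obtain ⟨q, hq, hd⟩ := hδ x y z f g k hf hg hk s hs
  refine ⟨q, ?_, hd⟩
  rcases hq with ⟨t, ht, rfl⟩ | ⟨t, ht, rfl⟩
  · exact Or.inr (hg.between ht).symm
  · exact Or.inl (hk.between ht)

theorem GromovHyperbolic.exists_between_quadrilateral (hX : GeodesicSpace X)
    (hδ₀ : 0 ≤ δ) (hδ : GromovHyperbolic X δ) {x y p : X} (h : MetricBetween x y p) (z w : X) :
    ∃ q, (MetricBetween x z q ∨ MetricBetween z w q ∨ MetricBetween w y q) ∧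
      dist p q ≤ 2 * δ := by
  obtain ⟨q, hq | hq, hd⟩ := hδ.exists_between hX h z
  · exact ⟨q, Or.inl hq, by linarith⟩
  · obtain ⟨q', hq', hd'⟩ := hδ.exists_between hX hq w
    exact ⟨q', Or.inr hq', by linarith [dist_triangle p q q']⟩

theorem QuasiconvexSet.exists_dist_le (hX : GeodesicSpace X) {C : ℝ} {A : Set X}
    (hA : QuasiconvexSet C A) {x y p : X} (hx : x ∈ A) (hy : y ∈ A) (h : MetricBetween x y p) :
    ∃ a ∈ A, dist p a ≤ C := by
  obtain ⟨f, hf, s, hs, rfl⟩ := h.exists_geodesic hX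
  exact hA x hx y hy f hf s hs

/-- In a hyperbolic space, opposite sides of one of the two pairs of a geodesic quadrilateral
come uniformly close to each other. -/
theorem GromovHyperbolic.exists_opposite_sides_close (hX : GeodesicSpace X)
    (hδ₀ : 0 ≤ δ) (hδ : GromovHyperbolic X δ) (a b c w : X) :
    ∃ p q, dist p q ≤ 2 * δ + 1 ∧
      ((MetricBetween a c p ∧ MetricBetween w b q) ∨
        (MetricBetween a w p ∧ MetricBetween c b q)) := by
  obtain ⟨g, hg⟩ := hX a b
  by_contra! hno
  set U : Set ℝ := {t | t ∈ Icc 0 (dist a b) ∧ (∃ q, MetricBetween a c q ∧ dist (g t) q ≤ δ) ∧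
    ∃ q, MetricBetween a w q ∧ dist (g t) q ≤ δ}
  set V : Set ℝ := {t | t ∈ Icc 0 (dist a b) ∧ (∃ q, MetricBetween c b q ∧ dist (g t) q ≤ δ) ∧
    ∃ q, MetricBetween w b q ∧ dist (g t) q ≤ δ}
  have cover : ∀ t ∈ Icc 0 (dist a b), t ∉ U → t ∈ V := by
    intro t ht htU
    obtain ⟨q₁, h₁, d₁⟩ := hδ.exists_between hX (hg.between ht) c
    obtain ⟨q₂, h₂, d₂⟩ := hδ.exists_between hX (hg.between ht) w
    have hq : dist q₁ q₂ ≤ 2 * δ + 1 := by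
      have := dist_triangle_left q₁ q₂ (g t)
      linarith
    rcases h₁ with h₁ | h₁ <;> rcases h₂ with h₂ | h₂
    · exact absurd ⟨ht, ⟨q₁, h₁, d₁⟩, q₂, h₂, d₂⟩ htU
    · exact absurd h₂ ((hno q₁ q₂ hq).1 h₁)
    · exact absurd h₁ ((hno q₂ q₁ (by rwa [dist_comm])).2 h₂)
    · exact ⟨ht, ⟨q₁, h₁, d₁⟩, q₂, h₂, d₂⟩
  have h0U : (0 : ℝ) ∈ U :=
    ⟨⟨le_rfl, dist_nonneg⟩, ⟨a, .left a c, by simpa [hg.1] using hδ₀⟩,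
      a, .left a w, by simpa [hg.1] using hδ₀⟩
  have hLV : dist a b ∈ V :=
    ⟨⟨dist_nonneg, le_rfl⟩, ⟨b, .right c b, by simpa [hg.2.1] using hδ₀⟩,
      b, .right w b, by simpa [hg.2.1] using hδ₀⟩
  have hbdd : BddAbove U := ⟨dist a b, fun t ht => ht.1.2⟩
  obtain ⟨u, hu, hlt⟩ := exists_lt_of_lt_csSup ⟨0, h0U⟩ 
    (show sSup U - 1 / 2 < sSup U by linarith)
  have huS : u ≤ sSup U := le_csSup hbdd hu
  obtain ⟨t, ht, htu⟩ : ∃ t ∈ V, |u - t| ≤ 1 := by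
    by_cases hcase : sSup U + 1 / 2 ≤ dist a b
    · refine ⟨sSup U + 1 / 2, cover _ ⟨by linarith [hu.1.1], hcase⟩ fun hmem => ?_, ?_⟩
      · linarith [le_csSup hbdd hmem]
      · rw [abs_le]; constructor <;> linarith
    · refine ⟨_, hLV, ?_⟩
      rw [abs_le]; constructor <;> linarith [hu.1.2]
  obtain ⟨q₁, h₁, d₁⟩ := hu.2.1
  obtain ⟨q₂, h₂, d₂⟩ := ht.2.2
  refine (hno q₁ q₂ ?_).1 h₁ h₂
  have h3 := hg.2.2 u hu.1 t ht.1
  have := dist_triangle4 q₁ (g u) (g t) q₂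
  rw [dist_comm q₁ (g u)] at this
  linarith

end Slim

section ElectricDistance

variable {X : Type*} [MetricSpace X] {𝓗 : Set (Set X)}

/-- `ElecChain 𝓗 n r x y`: there is a chain from `x` to `y` with `n` free jumps inside members
of `𝓗` and total cost at most `r`. -/
inductive ElecChain (𝓗 : Set (Set X)) : ℕ → ℝ → X → X → Prop
  | move {r : ℝ} {x y : X} : dist x y ≤ r → ElecChain 𝓗 0 r x y
  | jump {n : ℕ} {r s : ℝ} {x q p y : X} {A : Set X} : dist x q ≤ s → A ∈ 𝓗 → q ∈ A → p ∈ A →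
      ElecChain 𝓗 n r p y → ElecChain 𝓗 (n + 1) (s + r) x y

namespace ElecChain

theorem nonneg {n : ℕ} {r : ℝ} {x y : X} (h : ElecChain 𝓗 n r x y) : 0 ≤ r := by
  induction h with
  | move h => exact dist_nonneg.trans h
  | jump h _ _ _ _ ih => exact add_nonneg (dist_nonneg.trans h) ih

theorem move_trans {n : ℕ} {r s : ℝ} {x y z : X} (hxy : dist x y ≤ s)
    (h : ElecChain 𝓗 n r y z) : ElecChain 𝓗 n (s + r) x z := by
  cases h with
  | move h => exact .move ((dist_triangle x y z).trans (add_le_add hxy h))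
  | jump h hA hq hp hc =>
    rw [← add_assoc]
    exact .jump ((dist_triangle _ _ _).trans (add_le_add hxy h)) hA hq hp hc

theorem trans {n m : ℕ} {r s : ℝ} {x y z : X} (h : ElecChain 𝓗 n r x y)
    (h' : ElecChain 𝓗 m s y z) : ElecChain 𝓗 (n + m) (r + s) x z := by
  induction h with
  | move h => simpa using h'.move_trans h
  | jump h hA hq hp _ ih =>
    rw [Nat.add_right_comm, add_assoc _ _ s]
    exact .jump h hA hq hp (ih h')

theorem symm {n : ℕ} {r : ℝ} {x y : X} (h : ElecChain 𝓗 n r x y) : ElecChain 𝓗 n r y x := by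
  induction h with
  | move h => exact .move (by rwa [dist_comm])
  | @jump n r s x q p y A h hA hq hp _ ih =>
    have hback : ElecChain 𝓗 1 (0 + s) p x :=
      .jump (dist_self p).le hA hp hq (.move (by rwa [dist_comm]))
    have hyx := ih.trans hback
    rwa [zero_add, add_comm r s] at hyx

/-- In a separated collection, a chain can be shortened so that the number of jumps is bounded
linearly in terms of its cost. -/
theorem exists_few_jumps {D : ℝ} (hD : 0 < D) (hsep : SeparatedColl D 𝓗) {n : ℕ} {r : ℝ}
    {x y : X} (h : ElecChain 𝓗 n r x y) :
    ∃ m : ℕ, ∃ r' ≤ r, ElecChain 𝓗 m r' x y ∧ m * D ≤ r + D := by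
  suffices H : dist x y ≤ r ∨ ∃ (m : ℕ) (s t : ℝ) (A : Set X) (q p : X), dist x q ≤ t ∧ A ∈ 𝓗 ∧
      q ∈ A ∧ p ∈ A ∧ ElecChain 𝓗 m s p y ∧ t + s ≤ r ∧ m * D ≤ s by
    rcases H with H | ⟨m, s, t, A, q, p, h1, hA, hq, hp, hc, h2, h3⟩
    · refine ⟨0, r, le_rfl, .move H, ?_⟩
      have := h.nonneg
      simp only [Nat.cast_zero, zero_mul]
      linarith
    · refine ⟨m + 1, t + s, h2, .jump h1 hA hq hp hc, ?_⟩
      have : 0 ≤ t := dist_nonneg.trans h1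
      push_cast
      linarith
  induction h with
  | move h => exact Or.inl h
  | @jump n r s x q p y A h hA hq hp hc ih =>
    right
    rcases ih with ih | ⟨m, s', t, B, q', p', h1, hB, hq', hp', hc', h2, h3⟩
    · exact ⟨0, r, s, A, q, p, h, hA, hq, hp, .move ih, le_rfl, by simpa using hc.nonneg⟩
    · by_cases hAB : A = B
      · subst hAB
        have : 0 ≤ t := dist_nonneg.trans h1
        exact ⟨m, s', s, A, q, p', h, hA, hq, hp', hc', by linarith, h3⟩
      · refine ⟨m + 1, t + s', s, A, q, p, h, hA, hq, hp, .jump h1 hB hq' hp' hc',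
          by linarith, ?_⟩
        have := hsep A hA B hB hAB p hp q' hq'
        push_cast
        linarith

theorem of_fin {y : X} : ∀ (n : ℕ) (p q : Fin (n + 1) → X), q (Fin.last n) = y →
    (∀ i : Fin n, ∃ A ∈ 𝓗, q i.castSucc ∈ A ∧ p i.succ ∈ A) →
    ElecChain 𝓗 n (∑ i, dist (p i) (q i)) (p 0) y
  | 0, p, q, hq, _ => by
    subst hq
    exact .move (by simp)
  | n + 1, p, q, hq, hA => by
    rw [Fin.sum_univ_succ]
    obtain ⟨A, hA0, h1, h2⟩ := hA 0
    refine .jump le_rfl hA0 h1 h2 ?_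
    exact of_fin n (fun i => p i.succ) (fun i => q i.succ) hq fun i => by
      simpa using hA i.succ

theorem exists_fin {n : ℕ} {r : ℝ} {x y : X} (h : ElecChain 𝓗 n r x y) :
    ∃ p q : Fin (n + 1) → X, p 0 = x ∧ q (Fin.last n) = y ∧
      (∀ i : Fin n, ∃ A ∈ 𝓗, q i.castSucc ∈ A ∧ p i.succ ∈ A) ∧
      ∑ i, dist (p i) (q i) ≤ r := by
  induction h with
  | @move r x y h => exact ⟨fun _ => x, fun _ => y, rfl, rfl, fun i => i.elim0, by simpa using h⟩
  | @jump n r s x q p y A h hA hq hp _ ih =>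
    obtain ⟨P, Q, hP, hQ, hPQ, hr⟩ := ih
    refine ⟨Fin.cons x P, Fin.cons q Q, rfl, ?_, ?_, ?_⟩
    · rw [← Fin.succ_last, Fin.cons_succ, hQ]
    · intro i
      refine Fin.cases ?_ (fun i => ?_) i
      · exact ⟨A, hA, by simpa using hq, by simpa [hP] using hp⟩
      · simpa [← Fin.succ_castSucc] using hPQ i
    · rw [Fin.sum_univ_succ]
      simpa using add_le_add h hr

theorem elecDist_le {n : ℕ} {r : ℝ} {x y : X} (h : ElecChain 𝓗 n r x y) : elecDist 𝓗 x y ≤ r := by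
  obtain ⟨p, q, hp, hq, hA, hr⟩ := h.exists_fin
  refine le_trans (csInf_le ?_ ?_) hr
  · refine ⟨0, ?_⟩
    rintro _ ⟨n, p, q, -, -, -, rfl⟩
    exact Finset.sum_nonneg fun _ _ => dist_nonneg
  · exact ⟨n, p, q, hp, hq, hA, rfl⟩

end ElecChain

theorem exists_elecChain_of_elecDist_lt {x y : X} {s : ℝ} (h : elecDist 𝓗 x y < s) :
    ∃ n, ∃ r < s, ElecChain 𝓗 n r x y := by
  obtain ⟨r, ⟨n, p, q, rfl, hq, hA, rfl⟩, hr⟩ := exists_lt_of_csInf_lt (by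
    exact ⟨dist x y, 0, fun _ => x, fun _ => y, rfl, rfl, fun i => i.elim0, by simp⟩) h
  exact ⟨n, _, hr, .of_fin n p q hq hA⟩

variable (𝓗)

theorem elecDist_nonneg (x y : X) : 0 ≤ elecDist 𝓗 x y := by
  refine Real.sInf_nonneg ?_
  rintro _ ⟨n, p, q, -, -, -, rfl⟩
  exact Finset.sum_nonneg fun _ _ => dist_nonneg

theorem elecDist_le_dist (x y : X) : elecDist 𝓗 x y ≤ dist x y :=
  (ElecChain.move le_rfl).elecDist_le

theorem elecDist_comm (x y : X) : elecDist 𝓗 x y = elecDist 𝓗 y x := by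
  have H : ∀ u v : X, elecDist 𝓗 u v ≤ elecDist 𝓗 v u := fun u v =>
    le_of_forall_gt fun s hs => by
      obtain ⟨n, r, hr, hc⟩ := exists_elecChain_of_elecDist_lt hs
      exact hc.symm.elecDist_le.trans_lt hr
  exact le_antisymm (H x y) (H y x)

theorem elecDist_triangle (x y z : X) :
    elecDist 𝓗 x z ≤ elecDist 𝓗 x y + elecDist 𝓗 y z := by
  refine le_of_forall_pos_le_add fun ε hε => ?_
  obtain ⟨n, r, hr, hc⟩ := exists_elecChain_of_elecDist_lt
    (show elecDist 𝓗 x y < elecDist 𝓗 x y + ε / 2 by linarith)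
  obtain ⟨m, s, hs, hc'⟩ := exists_elecChain_of_elecDist_lt
    (show elecDist 𝓗 y z < elecDist 𝓗 y z + ε / 2 by linarith)
  linarith [(hc.trans hc').elecDist_le]

theorem elecDist_self (x : X) : elecDist 𝓗 x x = 0 :=
  le_antisymm (by simpa using elecDist_le_dist 𝓗 x x) (elecDist_nonneg 𝓗 x x)

theorem continuous_elecDist (p : X) : Continuous (elecDist 𝓗 p) := by
  refine LipschitzWith.continuous (K := 1) (LipschitzWith.of_le_add fun x y => ?_)
  have := elecDist_triangle 𝓗 p y x
  have := elecDist_le_dist 𝓗 y x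
  rw [dist_comm] at this
  linarith

variable {𝓗}

theorem elecDist_eq_zero_of_mem {A : Set X} (hA : A ∈ 𝓗) {x y : X} (hx : x ∈ A) (hy : y ∈ A) :
    elecDist 𝓗 x y = 0 := by
  refine le_antisymm ?_ (elecDist_nonneg 𝓗 x y)
  have h : ElecChain 𝓗 1 (0 + 0) x y :=
    .jump (dist_self x).le hA hx hy (.move (dist_self y).le)
  simpa using h.elecDist_le

theorem IsGeodesicFrom.continuousOn {x y : X} {f : ℝ → X} (hf : IsGeodesicFrom f x y) :
    ContinuousOn f (Icc 0 (dist x y)) := by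
  refine LipschitzOnWith.continuousOn (K := 1) (LipschitzOnWith.of_dist_le_mul fun s hs t ht => ?_)
  rw [hf.2.2 s hs t ht, Real.dist_eq]
  simp

/-- Walk from `p` towards `x` along a geodesic until the electric distance `T` from `p` is reached,
or until arriving at `x`. -/
theorem exists_between_elecDist_eq (hX : GeodesicSpace X) (p x : X) {T : ℝ} (hT : 0 ≤ T) :
    ∃ u, MetricBetween p x u ∧ elecDist 𝓗 p u ≤ T ∧ (elecDist 𝓗 p u = T ∨ u = x) := by
  by_cases h : elecDist 𝓗 p x ≤ T
  · exact ⟨x, .right p x, h, Or.inr rfl⟩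
  · obtain ⟨g, hg⟩ := hX p x
    have hc : ContinuousOn (fun t => elecDist 𝓗 p (g t)) (Icc 0 (dist p x)) :=
      (continuous_elecDist 𝓗 p).comp_continuousOn hg.continuousOn
    obtain ⟨t, ht, hte⟩ := intermediate_value_Icc dist_nonneg hc
      (show T ∈ Icc _ _ by
        simp only [hg.1, hg.2.1, elecDist_self]
        exact ⟨hT, (not_le.1 h).le⟩)
    exact ⟨g t, hg.between ht, le_of_eq hte, Or.inl hte⟩

/-- A step of cost `c`: a move of length at most `min c 1`, or a jump in a member of `𝓗`. -/
def ElecStep (𝓗 : Set (Set X)) (c : ℝ) (u v : X) : Prop :=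
  0 ≤ c ∧ ((dist u v ≤ c ∧ dist u v ≤ 1) ∨ ∃ A ∈ 𝓗, u ∈ A ∧ v ∈ A)

theorem ElecStep.elecDist_le {c : ℝ} {u v : X} (h : ElecStep 𝓗 c u v) : elecDist 𝓗 u v ≤ c := by
  rcases h with ⟨h0, ⟨h, -⟩ | ⟨A, hA, hu, hv⟩⟩
  · exact (elecDist_le_dist 𝓗 u v).trans h
  · exact (elecDist_eq_zero_of_mem hA hu hv).trans_le h0

/-- A walk of `n` steps with total cost `r`. -/
inductive ElecWalk (𝓗 : Set (Set X)) : ℕ → ℝ → X → X → Prop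
  | nil {x : X} : ElecWalk 𝓗 0 0 x x
  | cons {n : ℕ} {c r : ℝ} {x y z : X} : ElecStep 𝓗 c x y → ElecWalk 𝓗 n r y z →
      ElecWalk 𝓗 (n + 1) (c + r) x z

namespace ElecWalk

theorem trans {n m : ℕ} {r s : ℝ} {x y z : X} (h : ElecWalk 𝓗 n r x y)
    (h' : ElecWalk 𝓗 m s y z) : ElecWalk 𝓗 (n + m) (r + s) x z := by
  induction h with
  | nil => simpa using h'
  | cons h _ ih =>
    rw [Nat.add_right_comm, add_assoc _ _ s]
    exact .cons h (ih h')

theorem elecDist_le {n : ℕ} {r : ℝ} {x y : X} (h : ElecWalk 𝓗 n r x y) : elecDist 𝓗 x y ≤ r := by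
  induction h with
  | nil => exact (elecDist_self 𝓗 _).le
  | cons h _ ih => exact (elecDist_triangle 𝓗 _ _ _).trans (add_le_add h.elecDist_le ih)

theorem of_dist_le (hX : GeodesicSpace X) (n : ℕ) : ∀ {x y : X}, dist x y ≤ n →
    ∃ k ≤ n, ElecWalk 𝓗 k (dist x y) x y := by
  induction n with
  | zero =>
    intro x y h
    have : x = y := dist_le_zero.1 (by simpa using h)
    subst this
    exact ⟨0, le_rfl, by simpa using ElecWalk.nil⟩
  | succ n ih =>
    intro x y h
    by_cases h1 : dist x y ≤ 1
    · refine ⟨1, by omega, ?_⟩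
      simpa using ElecWalk.cons (𝓗 := 𝓗) ⟨dist_nonneg, Or.inl ⟨le_rfl, h1⟩⟩ .nil
    · obtain ⟨g, hg⟩ := hX x y
      have hm : (1 : ℝ) ∈ Icc 0 (dist x y) := ⟨zero_le_one, (not_le.1 h1).le⟩
      have e1 := hg.dist_left hm
      have e2 := hg.dist_right hm
      push_cast at h
      obtain ⟨k, hk, hw⟩ := ih (x := g 1) (y := y) (by linarith)
      refine ⟨k + 1, by omega, ?_⟩
      have hw' := ElecWalk.cons (𝓗 := 𝓗) (c := 1) (x := x)
        ⟨zero_le_one, Or.inl ⟨e1.le, e1.le⟩⟩ hw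
      rw [e2, add_sub_cancel] at hw'
      exact hw'

theorem exists_fun {n : ℕ} {r : ℝ} {x y : X} (h : ElecWalk 𝓗 n r x y) :
    ∃ (v : ℕ → X) (c : ℕ → ℝ), v 0 = x ∧ v n = y ∧
      (∀ i < n, ElecStep 𝓗 (c i) (v i) (v (i + 1))) ∧ ∑ i ∈ Finset.range n, c i = r := by
  induction h with
  | @nil x => exact ⟨fun _ => x, fun _ => 0, rfl, rfl, by simp, by simp⟩
  | @cons n c r x y z h _ ih =>
    obtain ⟨v, d, h0, hn, hs, hr⟩ := ih
    refine ⟨fun i => Nat.casesOn i x v, fun i => Nat.casesOn i c d, rfl, hn, ?_, ?_⟩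
    · rintro (_ | i) hi
      · simpa [h0] using h
      · exact hs i (by omega)
    · rw [Finset.sum_range_succ']
      change ∑ i ∈ Finset.range n, d i + c = c + r
      rw [hr, add_comm]

theorem of_fun {v : ℕ → X} {c : ℕ → ℝ} {n : ℕ}
    (h : ∀ i < n, ElecStep 𝓗 (c i) (v i) (v (i + 1))) (k : ℕ) : ∀ i, i + k ≤ n →
      ElecWalk 𝓗 k (∑ l ∈ Finset.range (i + k), c l - ∑ l ∈ Finset.range i, c l)
        (v i) (v (i + k)) := by
  induction k with
  | zero =>
    intro i _
    simpa using ElecWalk.nil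
  | succ k ih =>
    intro i hi
    have hw := ElecWalk.cons (h i (by omega)) (ih (i + 1) (by omega))
    rw [Finset.sum_range_succ _ i, show i + 1 + k = i + (k + 1) by omega] at hw
    convert hw using 1
    ring

end ElecWalk

theorem ElecChain.exists_walk (hX : GeodesicSpace X) {n : ℕ} {r : ℝ} {x y : X}
    (h : ElecChain 𝓗 n r x y) :
    ∃ k : ℕ, ∃ r' ≤ r, ElecWalk 𝓗 k r' x y ∧ (k : ℝ) ≤ r + 2 * n + 1 := by
  have H : ∀ {x y : X} {r : ℝ}, dist x y ≤ r →
      ∃ k : ℕ, ElecWalk 𝓗 k (dist x y) x y ∧ (k : ℝ) ≤ r + 1 := by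
    intro x y r hr
    obtain ⟨k, hk, hw⟩ := ElecWalk.of_dist_le (𝓗 := 𝓗) hX ⌈r⌉₊ (hr.trans (Nat.le_ceil r))
    refine ⟨k, hw, ?_⟩
    have h1 := Nat.ceil_lt_add_one (dist_nonneg.trans hr)
    have h2 : (k : ℝ) ≤ ⌈r⌉₊ := by exact_mod_cast hk
    linarith
  induction h with
  | move h =>
    obtain ⟨k, hw, hk⟩ := H h
    exact ⟨k, _, h, hw, by simpa using hk⟩
  | jump h hA hq hp _ ih =>
    obtain ⟨k, hw, hk⟩ := H h
    obtain ⟨k', r', hr', hw', hk'⟩ := ih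
    refine ⟨_, _, ?_, hw.trans (.cons (c := 0) ⟨le_rfl, Or.inr ⟨_, hA, hq, hp⟩⟩ hw'), ?_⟩
    · linarith
    · push_cast
      linarith

/-- Any two points are joined by a discrete path that is almost geodesic for the electric
distance, and whose number of steps is controlled linearly on every subpath. -/
theorem exists_discrete_quasigeodesic (hX : GeodesicSpace X) {D : ℝ} (hD : 0 < D)
    (hsep : SeparatedColl D 𝓗) (x y : X) :
    ∃ (N : ℕ) (v : ℕ → X), v 0 = x ∧ v N = y ∧
      (∀ i < N, ∃ c, ElecStep 𝓗 c (v i) (v (i + 1))) ∧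
      (∀ l ≤ N, elecDist 𝓗 x (v l) + elecDist 𝓗 (v l) y ≤ elecDist 𝓗 x y + 1) ∧
      ∀ i k, i + k ≤ N → (k : ℝ) ≤ (4 + 2 / D) * (elecDist 𝓗 (v i) (v (i + k)) + 1) := by
  classical
  have hex : ∃ n : ℕ, ∃ r < elecDist 𝓗 x y + 1, ElecWalk 𝓗 n r x y := by
    obtain ⟨n, r, hr, hc⟩ := exists_elecChain_of_elecDist_lt (lt_add_one (elecDist 𝓗 x y))
    obtain ⟨k, r', hr', hw, -⟩ := hc.exists_walk hX
    exact ⟨k, r', by linarith, hw⟩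
  obtain ⟨r, hr, hw⟩ := Nat.find_spec hex
  have hmin : ∀ m, ∀ s < elecDist 𝓗 x y + 1, ElecWalk 𝓗 m s x y → Nat.find hex ≤ m :=
    fun m s hs h => Nat.find_min' hex ⟨s, hs, h⟩
  set N := Nat.find hex
  obtain ⟨v, c, h0, hN, hstep, hsum⟩ := hw.exists_fun
  have sub := ElecWalk.of_fun hstep
  have pre : ∀ i ≤ N, ElecWalk 𝓗 i (∑ l ∈ Finset.range i, c l) x (v i) := by
    intro i hi
    simpa [h0] using sub i 0 (by omega)
  have suf : ∀ i ≤ N, ElecWalk 𝓗 (N - i) (r - ∑ l ∈ Finset.range i, c l) (v i) y := by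
    intro i hi
    have := sub (N - i) i (by omega)
    rwa [Nat.add_sub_cancel' hi, hsum, hN] at this
  refine ⟨N, v, h0, hN, fun i hi => ⟨_, hstep i hi⟩, fun l hl => ?_, fun i k hik => ?_⟩
  · linarith [(pre l hl).elecDist_le, (suf l hl).elecDist_le]
  · have hmid := (sub k i hik).elecDist_le
    have hall := hw.elecDist_le
    obtain ⟨n, s, hs, hc⟩ := exists_elecChain_of_elecDist_lt
      (show elecDist 𝓗 (v i) (v (i + k)) <
        elecDist 𝓗 (v i) (v (i + k)) + (elecDist 𝓗 x y + 1 - r) by linarith)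
    obtain ⟨m, s', hs', hc', hm⟩ := hc.exists_few_jumps hD hsep
    obtain ⟨q, s'', hs'', hw', hq⟩ := hc'.exists_walk hX
    have hle := hmin _ _ ?_ (((pre i (by omega)).trans hw').trans (suf (i + k) hik))
    · have hkq : (k : ℝ) ≤ q := by
        have : k ≤ q := by omega
        exact_mod_cast this
      have hm' : (m : ℝ) ≤ s / D + 1 := by
        rw [← sub_le_iff_le_add, le_div_iff₀ hD]
        linarith
      have hsd : s / D ≤ (elecDist 𝓗 (v i) (v (i + k)) + 1) / D := by
        gcongr
        linarith
      have hnn := elecDist_nonneg 𝓗 (v i) (v (i + k))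
      have e : (4 + 2 / D) * (elecDist 𝓗 (v i) (v (i + k)) + 1) =
        4 * (elecDist 𝓗 (v i) (v (i + k)) + 1)
          + 2 * ((elecDist 𝓗 (v i) (v (i + k)) + 1) / D) := by ring
      rw [e]
      linarith
    · linarith

end ElectricDistance

section Hyperbolicity

variable {X : Type*} [MetricSpace X] {𝓗 : Set (Set X)} {δ C : ℝ}

theorem exists_elecDist_le_of_step (hX : GeodesicSpace X) (hC : 0 ≤ C)
    (hqc : ∀ A ∈ 𝓗, QuasiconvexSet C A) {c : ℝ} {u v p : X} (h : ElecStep 𝓗 c u v)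
    (hp : MetricBetween u v p) : elecDist 𝓗 p u ≤ C + 1 := by
  rcases h.2 with ⟨-, h1⟩ | ⟨A, hA, hu, hv⟩
  · have h2 := elecDist_le_dist 𝓗 p u
    unfold MetricBetween at hp
    rw [dist_comm] at h2
    linarith [dist_nonneg (x := p) (y := v)]
  · obtain ⟨a, ha, hd⟩ := (hqc A hA).exists_dist_le hX hu hv hp
    have h1 := elecDist_triangle 𝓗 p a u
    rw [elecDist_eq_zero_of_mem hA ha hu] at h1
    linarith [elecDist_le_dist 𝓗 p a]

/-- Geodesics stay logarithmically close to discrete paths. -/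
theorem exists_elecDist_le_of_path (hX : GeodesicSpace X) (hδ : GromovHyperbolic X δ)
    (hC : 0 ≤ C) (hqc : ∀ A ∈ 𝓗, QuasiconvexSet C A) {N : ℕ} {v : ℕ → X}
    (hv : ∀ i < N, ∃ c, ElecStep 𝓗 c (v i) (v (i + 1))) (m : ℕ) :
    ∀ i k, k ≤ 2 ^ m → i + k ≤ N → ∀ p, MetricBetween (v i) (v (i + k)) p →
      ∃ l ≤ N, elecDist 𝓗 p (v l) ≤ m * δ + (C + 1) := by
  induction m with
  | zero =>
    intro i k hk hik p hp
    refine ⟨i, by omega, ?_⟩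
    rw [pow_zero] at hk
    rcases Nat.le_one_iff_eq_zero_or_eq_one.1 hk with rfl | rfl
    · rw [hp.eq_of_self, elecDist_self]
      simp only [Nat.cast_zero, zero_mul]
      linarith
    · obtain ⟨c, hc⟩ := hv i (by omega)
      simpa using exists_elecDist_le_of_step hX hC hqc hc hp
  | succ m ih =>
    intro i k hk hik p hp
    rw [pow_succ] at hk
    obtain ⟨q, hq, hd⟩ := hδ.exists_between hX hp (v (i + k / 2))
    have : ∃ l ≤ N, elecDist 𝓗 q (v l) ≤ m * δ + (C + 1) := by
      rcases hq with hq | hq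
      · exact ih i (k / 2) (by omega) (by omega) q hq
      · refine ih (i + k / 2) (k - k / 2) (by omega) (by omega) q ?_
        rwa [show i + k / 2 + (k - k / 2) = i + k by omega]
    obtain ⟨l, hl, hle⟩ := this
    refine ⟨l, hl, ?_⟩
    push_cast
    linarith [elecDist_triangle 𝓗 p q (v l), elecDist_le_dist 𝓗 p q]

theorem exists_le_two_pow_of_pos (δ : ℝ) (hδ : 0 ≤ δ) {η : ℝ} (hη : 0 < η) :
    ∃ B : ℝ, 0 ≤ B ∧ ∀ n : ℕ, ∃ m : ℕ, n ≤ 2 ^ m ∧ m * δ ≤ η * n + B := by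
  have ht := tendsto_pow_const_div_const_pow_of_one_lt 1 (one_lt_two (α := ℝ))
  obtain ⟨M, hM⟩ := Filter.eventually_atTop.1
    (ht.eventually_lt_const (show 0 < η / (δ + 1) by positivity))
  refine ⟨(M + 1) * δ, by positivity, fun n => ⟨Nat.clog 2 n, Nat.le_pow_clog one_lt_two n, ?_⟩⟩
  rcases Nat.le_total (Nat.clog 2 n) (M + 1) with h | h
  · have h' : (Nat.clog 2 n : ℝ) ≤ M + 1 := by exact_mod_cast h
    have h1 : (Nat.clog 2 n : ℝ) * δ ≤ (M + 1) * δ := by gcongr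
    have h2 : 0 ≤ η * n := by positivity
    linarith
  · obtain ⟨m, hm⟩ : ∃ m, Nat.clog 2 n = m + 1 := ⟨Nat.clog 2 n - 1, by omega⟩
    have hlt : 2 ^ m < n := (Nat.lt_clog_iff_pow_lt one_lt_two).1 (by omega)
    have hlt' : (2 : ℝ) ^ m < n := by exact_mod_cast hlt
    have h1 := hM m (by omega)
    rw [pow_one, div_lt_div_iff₀ (by positivity) (by positivity)] at h1
    have h2 : η * 2 ^ m ≤ η * n := by gcongr
    have h3 : (0 : ℝ) ≤ m := by positivity
    have h4 : (0 : ℝ) ≤ M * δ := by positivity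
    rw [hm]
    push_cast
    nlinarith

/-- The deviation of a geodesic from an almost geodesic discrete path for the electric distance
grows sublinearly. -/
theorem exists_sublinear_deviation {δ C D : ℝ} (hδ₀ : 0 ≤ δ) (hC : 0 ≤ C) (hD : 0 < D) {η : ℝ}
    (hη : 0 < η) :
    ∃ B : ℝ, 0 ≤ B ∧ ∀ (X : Type*) [MetricSpace X], GeodesicSpace X → GromovHyperbolic X δ →
      ∀ 𝓗 : Set (Set X), (∀ A ∈ 𝓗, QuasiconvexSet C A) → SeparatedColl D 𝓗 → ∀ x y : X,
        ∃ (N : ℕ) (v : ℕ → X), v 0 = x ∧ v N = y ∧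
          (∀ l ≤ N, elecDist 𝓗 x (v l) + elecDist 𝓗 (v l) y ≤ elecDist 𝓗 x y + 1) ∧
          ∀ i ≤ N, ∀ j ≤ N, ∀ p, MetricBetween (v i) (v j) p →
            ∃ l ≤ N, elecDist 𝓗 p (v l) ≤ η * elecDist 𝓗 (v i) (v j) + B := by
  have hK : 0 < 4 + 2 / D := by positivity
  obtain ⟨B, hB, hpow⟩ := exists_le_two_pow_of_pos δ hδ₀ (div_pos hη hK)
  refine ⟨B + η + (C + 1), by positivity, fun X _ hX hδ 𝓗 hqc hsep x y => ?_⟩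
  obtain ⟨N, v, h0, hN, hstep, hgeod, hlin⟩ := exists_discrete_quasigeodesic hX hD hsep x y
  refine ⟨N, v, h0, hN, hgeod, ?_⟩
  have main : ∀ i k, i + k ≤ N → ∀ p, MetricBetween (v i) (v (i + k)) p →
      ∃ l ≤ N, elecDist 𝓗 p (v l) ≤
        η * elecDist 𝓗 (v i) (v (i + k)) + (B + η + (C + 1)) := by
    intro i k hik p hp
    obtain ⟨m, hm, hmδ⟩ := hpow k
    obtain ⟨l, hl, hle⟩ := exists_elecDist_le_of_path hX hδ hC hqc hstep m i k hm hik p hp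
    refine ⟨l, hl, ?_⟩
    have h1 : η / (4 + 2 / D) * k ≤
        η / (4 + 2 / D) * ((4 + 2 / D) * (elecDist 𝓗 (v i) (v (i + k)) + 1)) := by
      gcongr
      exact hlin i k hik
    rw [← mul_assoc, div_mul_cancel₀ _ hK.ne'] at h1
    linarith
  intro i hi j hj p hp
  rcases Nat.le_total i j with hij | hij
  · obtain ⟨k, rfl⟩ := Nat.exists_eq_add_of_le hij
    exact main i k hj p hp
  · obtain ⟨k, rfl⟩ := Nat.exists_eq_add_of_le hij
    rw [elecDist_comm]
    exact main j k hi p hp.symm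

/-- Points on a geodesic are, up to a uniform error, between its endpoints for the electric
distance. -/
theorem exists_elecDist_add_le {δ C D : ℝ} (hδ₀ : 0 ≤ δ) (hC : 0 ≤ C) (hD : 0 < D) :
    ∃ K : ℝ, 0 ≤ K ∧ ∀ (X : Type*) [MetricSpace X], GeodesicSpace X → GromovHyperbolic X δ →
      ∀ 𝓗 : Set (Set X), (∀ A ∈ 𝓗, QuasiconvexSet C A) → SeparatedColl D 𝓗 → ∀ x y p : X,
        MetricBetween x y p → elecDist 𝓗 x p + elecDist 𝓗 p y ≤ elecDist 𝓗 x y + K := by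
  obtain ⟨B, hB, hdev⟩ := exists_sublinear_deviation hδ₀ hC hD (η := 1 / 12) (by norm_num)
  set c := 2 * δ + B + 2 with hc
  set B' := 2 * δ + c + B with hB'
  refine ⟨2 * (2 * B' + 2) + 1, by positivity, fun X _ hX hδ 𝓗 hqc hsep x y => ?_⟩
  obtain ⟨N, v, h0, hN, hgeod, hlog⟩ := hdev X hX hδ 𝓗 hqc hsep x y
  set S : Set ℝ := {ρ | 0 ≤ ρ ∧ ∀ p, MetricBetween x y p → ∃ l ≤ N, elecDist 𝓗 p (v l) ≤ ρ}
  have hne : S.Nonempty := by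
    refine ⟨1 / 12 * elecDist 𝓗 x y + B, ?_, fun p hp => ?_⟩
    · have := elecDist_nonneg 𝓗 x y
      positivity
    · simpa only [h0, hN] using hlog 0 (Nat.zero_le N) N le_rfl p (by rwa [h0, hN])
  have contract : ∀ ρ ∈ S, ρ / 2 + B' ∈ S := by
    rintro ρ ⟨hρ, hρS⟩
    refine ⟨by positivity, fun p hp => ?_⟩
    have hT : 0 ≤ 2 * ρ + c := by positivity
    have ends : ∀ e, MetricBetween x y e → (∃ i ≤ N, e = v i) →
        ∀ u, MetricBetween x y u → (elecDist 𝓗 p u = 2 * ρ + c ∨ u = e) →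
        ∃ i ≤ N, elecDist 𝓗 u (v i) ≤ ρ ∧ (elecDist 𝓗 p u = 2 * ρ + c ∨ u = v i) := by
      rintro e - ⟨i, hi, rfl⟩ u hu (h | rfl)
      · obtain ⟨i, hi, hle⟩ := hρS u hu
        exact ⟨i, hi, hle, Or.inl h⟩
      · exact ⟨i, hi, by rwa [elecDist_self], Or.inr rfl⟩
    obtain ⟨x', hx', hx'T, hx'e⟩ := exists_between_elecDist_eq (𝓗 := 𝓗) hX p x hT
    obtain ⟨y', hy', hy'T, hy'e⟩ := exists_between_elecDist_eq (𝓗 := 𝓗) hX p y hT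
    obtain ⟨i, hi, hiρ, hie⟩ := ends x (.left x y) ⟨0, Nat.zero_le N, h0.symm⟩ x'
      (hp.trans_left hx') hx'e
    obtain ⟨j, hj, hjρ, hje⟩ := ends y (.right x y) ⟨N, le_rfl, hN.symm⟩ y'
      (hp.symm.trans_left hy').symm hy'e
    have side : ∀ u, ∀ k ≤ N, elecDist 𝓗 u (v k) ≤ ρ →
        (elecDist 𝓗 p u = 2 * ρ + c ∨ u = v k) → ∀ q, MetricBetween u (v k) q →
        dist p q ≤ 2 * δ → ∃ l ≤ N, elecDist 𝓗 p (v l) ≤ ρ / 2 + B' := by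
      rintro u k hk hkρ (he | rfl) q hq hd
      · exfalso
        obtain ⟨M, w, hw0, hwM, hwg, hwl⟩ := hdev X hX hδ 𝓗 hqc hsep u (v k)
        obtain ⟨l, hl, hle⟩ := hwl 0 (Nat.zero_le M) M le_rfl q (by rwa [hw0, hwM])
        rw [hw0, hwM] at hle
        have h1 := hwg l hl
        have h2 := elecDist_nonneg 𝓗 (w l) (v k)
        have h3 := elecDist_triangle 𝓗 p q u
        have h4 := elecDist_triangle 𝓗 q (w l) u
        have h5 := elecDist_le_dist 𝓗 p q
        rw [elecDist_comm 𝓗 (w l) u] at h4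
        linarith
      · refine ⟨k, hk, ?_⟩
        rw [← hq.eq_of_self]
        have := elecDist_le_dist 𝓗 p q
        have : 0 ≤ c := by positivity
        linarith
    obtain ⟨q, hq, hd⟩ := hδ.exists_between_quadrilateral hX hδ₀
      (hp.between_of_halves hx' hy') (v i) (v j)
    rcases hq with hq | hq | hq
    · exact side x' i hi hiρ hie q hq hd
    · obtain ⟨l, hl, hle⟩ := hlog i hi j hj q hq
      refine ⟨l, hl, ?_⟩
      have h1 := elecDist_triangle 𝓗 (v i) x' (v j)
      have h2 := elecDist_triangle 𝓗 x' y' (v j)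
      have h3 := elecDist_triangle 𝓗 x' p y'
      have h4 := elecDist_triangle 𝓗 p q (v l)
      have h5 := elecDist_le_dist 𝓗 p q
      rw [elecDist_comm 𝓗 (v i) x'] at h1
      rw [elecDist_comm 𝓗 x' p] at h3
      have : 0 ≤ c := by positivity
      linarith
    · exact side y' j hj hjρ hje q hq.symm hd
  intro p hp
  have hbdd : BddBelow S := ⟨0, fun ρ hρ => hρ.1⟩
  obtain ⟨ρ, hρ, hlt⟩ := exists_lt_of_csInf_lt hne (lt_add_one (sInf S))
  have hle := csInf_le hbdd (contract ρ hρ)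
  obtain ⟨l, hl, hpl⟩ := hρ.2 p hp
  have h1 := elecDist_triangle 𝓗 x (v l) p
  have h2 := elecDist_triangle 𝓗 p (v l) y
  have h3 := hgeod l hl
  rw [elecDist_comm 𝓗 (v l) p] at h1
  linarith

end Hyperbolicity

/-- For all `δ ≥ 0`, `C ≥ 0`, `D > 0` there exists `Δ ≥ 0` such that: if
`(X, d)` is a `δ`-hyperbolic geodesic metric space and `𝓗` is a collection of
`C`-quasiconvex, `D`-separated subsets of `X`, then the electric pseudometric space
`(X, d_e)` is `Δ`-hyperbolic in the sense of the Gromov four-point inequality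
`(a,b)_w ≥ min((a,c)_w, (c,b)_w) − Δ`. -/
theorem electric_space_is_hyperbolic :
    ∀ δ C D : ℝ, 0 ≤ δ → 0 ≤ C → 0 < D →
      ∃ Δ : ℝ, 0 ≤ Δ ∧
        ∀ (X : Type) [MetricSpace X], GeodesicSpace X → GromovHyperbolic X δ →
          ∀ 𝓗 : Set (Set X), (∀ A ∈ 𝓗, QuasiconvexSet C A) → SeparatedColl D 𝓗 →
            ∀ a b c w : X,
              min ((elecDist 𝓗 a w + elecDist 𝓗 c w - elecDist 𝓗 a c) / 2)
                  ((elecDist 𝓗 c w + elecDist 𝓗 b w - elecDist 𝓗 c b) / 2) - Δ ≤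
                (elecDist 𝓗 a w + elecDist 𝓗 b w - elecDist 𝓗 a b) / 2 := by
  intro δ C D hδ₀ hC hD
  obtain ⟨K, hK, hbtw⟩ := exists_elecDist_add_le hδ₀ hC hD
  refine ⟨K + (2 * δ + 1), by positivity, fun X _ hX hδ 𝓗 hqc hsep a b c w => ?_⟩
  have hbtw := hbtw X hX hδ 𝓗 hqc hsep
  have tri := elecDist_triangle 𝓗
  have comm := elecDist_comm 𝓗
  obtain ⟨p, q, hpq, ⟨hp, hq⟩ | ⟨hp, hq⟩⟩ := hδ.exists_opposite_sides_close hX hδ₀ a b c w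
  · refine (sub_le_sub_right (min_le_left _ _) _).trans ?_
    linarith [hbtw _ _ _ hp, hbtw _ _ _ hq, elecDist_le_dist 𝓗 p q, tri a p b, tri p q b,
      tri c p w, tri p q w, comm c p, comm q w, comm b w]
  · refine (sub_le_sub_right (min_le_right _ _) _).trans ?_
    linarith [hbtw _ _ _ hp, hbtw _ _ _ hq, elecDist_le_dist 𝓗 p q, tri a p b, tri p q b,
      tri c q w, tri q p w, comm q p]
end

section
/- Quasi-isometries and nearest-point projections almost commute: suppose (Y₁,d₁) and (Y₂,d₂) are δ-hyperbolic geodesic metric spaces. Let μ₁ be a geodesic segment in Y₁ joining a and b, let p ∈ Y₁, and let q be a point on μ₁ with d₁(p,q) ≤ d₁(p,x) for all x ∈ μ₁. Let φ: Y₁ → Y₂ be a (K,ε)-quasi-isometric embedding, let μ₂ be a geodesic segment in Y₂ joining φ(a) and φ(b), and let r be a point on μ₂ with d₂(φ(p),r) ≤ d₂(φ(p),x) for all x ∈ μ₂. Then d₂(r,φ(q)) ≤ C₄ for a constant C₄ depending only on K, ε and δ. -/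
open Metric Set

/-- `w` lies metrically between `x` and `y`; in a geodesic space this says that `w` lies on some
geodesic from `x` to `y`. -/
def MetricBtw {X : Type*} [MetricSpace X] (x w y : X) : Prop :=
  dist x w + dist w y = dist x y

/-- Slimness of triangles, phrased through metric betweenness. -/
def SlimTriangles (X : Type*) [MetricSpace X] (δ : ℝ) : Prop :=
  ∀ x y z w : X, MetricBtw x w y →
    ∃ v, (MetricBtw y v z ∨ MetricBtw x v z) ∧ dist w v ≤ δ

section Geodesics

variable {X : Type*} [MetricSpace X]

lemma MetricBtw.symm {x w y : X} (h : MetricBtw x w y) : MetricBtw y w x := by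
  unfold MetricBtw at *
  rw [dist_comm y w, dist_comm w x, dist_comm y x]
  linarith

lemma metricBtw_left (x y : X) : MetricBtw x x y := by
  simp [MetricBtw]

lemma MetricBtw.trans_left {a v q b : X} (hv : MetricBtw a v q) (hq : MetricBtw a q b) :
    MetricBtw a v b := by
  unfold MetricBtw at *
  linarith [dist_triangle v q b, dist_triangle a v b]

/-- If `w` and `w'` are chosen on either side of `z` on a segment, then `z` is between them. -/
lemma MetricBtw.inner {x w z w' y : X} (h : MetricBtw x z y) (hw : MetricBtw x w z)
    (hw' : MetricBtw z w' y) : MetricBtw w z w' := by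
  unfold MetricBtw at *
  linarith [dist_triangle w z w', dist_triangle x w y, dist_triangle w w' y]

lemma MetricBtw.dist_add_dist_le {x v y w : X} {R : ℝ} (h : MetricBtw x v y)
    (hw : dist w v ≤ R) : dist x w + dist w y ≤ dist x y + 2 * R := by
  unfold MetricBtw at h
  linarith [dist_triangle x v w, dist_triangle w v y, dist_comm v w]

lemma IsGeodesicFrom.dist_left_s5 {f : ℝ → X} {x y : X} (hf : IsGeodesicFrom f x y) {s : ℝ}
    (hs : s ∈ Icc 0 (dist x y)) : dist x (f s) = s := by
  have h := hf.2.2 0 ⟨le_rfl, dist_nonneg⟩ s hs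
  rw [hf.1] at h
  rw [h, zero_sub, abs_neg, abs_of_nonneg hs.1]

lemma IsGeodesicFrom.dist_right_s5 {f : ℝ → X} {x y : X} (hf : IsGeodesicFrom f x y) {s : ℝ}
    (hs : s ∈ Icc 0 (dist x y)) : dist (f s) y = dist x y - s := by
  have h := hf.2.2 s hs _ ⟨dist_nonneg, le_rfl⟩
  rw [hf.2.1] at h
  rw [h, abs_sub_comm, abs_of_nonneg (by linarith [hs.2])]

lemma IsGeodesicFrom.metricBtw {f : ℝ → X} {x y : X} (hf : IsGeodesicFrom f x y) {s : ℝ}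
    (hs : s ∈ Icc 0 (dist x y)) : MetricBtw x (f s) y := by
  unfold MetricBtw
  rw [hf.dist_left_s5 hs, hf.dist_right_s5 hs]
  ring

/-- A point metrically between `x` and `y` lies on a geodesic from `x` to `y`. -/
lemma GeodesicSpace.exists_through (hX : GeodesicSpace X) {x w y : X} (h : MetricBtw x w y) :
    ∃ f, IsGeodesicFrom f x y ∧ f (dist x w) = w := by
  obtain ⟨f₁, h₁⟩ := hX x w
  obtain ⟨f₂, h₂⟩ := hX w y
  unfold MetricBtw at h
  have hmixed : ∀ s ∈ Icc 0 (dist x y), ∀ t ∈ Icc 0 (dist x y), s ≤ dist x w → dist x w < t →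
      dist (f₁ s) (f₂ (t - dist x w)) = t - s := by
    intro s hs t ht hsd htd
    have hs' : s ∈ Icc 0 (dist x w) := ⟨hs.1, hsd⟩
    have ht' : t - dist x w ∈ Icc 0 (dist w y) := ⟨by linarith, by linarith [ht.2]⟩
    have e₁ := h₁.dist_left_s5 hs'
    have e₂ := h₁.dist_right_s5 hs'
    have e₃ := h₂.dist_left_s5 ht'
    have e₄ := h₂.dist_right_s5 ht'
    linarith [dist_triangle (f₁ s) w (f₂ (t - dist x w)),
      dist_triangle4 x (f₁ s) (f₂ (t - dist x w)) y]
  refine ⟨fun t => if t ≤ dist x w then f₁ t else f₂ (t - dist x w), ⟨?_, ?_, ?_⟩, ?_⟩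
  · simp [h₁.1]
  · by_cases hwy : dist x y ≤ dist x w
    · have h0 : dist w y = 0 := le_antisymm (by linarith) dist_nonneg
      have hy := dist_eq_zero.1 h0
      subst hy
      simp [h₁.2.1]
    · have e : dist x y - dist x w = dist w y := by linarith
      simp only [if_neg hwy, e, h₂.2.1]
  · intro s hs t ht
    by_cases hsd : s ≤ dist x w <;> by_cases htd : t ≤ dist x w
    · simp only [if_pos hsd, if_pos htd]
      exact h₁.2.2 s ⟨hs.1, hsd⟩ t ⟨ht.1, htd⟩
    · simp only [if_pos hsd, if_neg htd]
      rw [hmixed s hs t ht hsd (not_le.1 htd), abs_sub_comm, abs_of_nonneg (by linarith)]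
    · simp only [if_neg hsd, if_pos htd]
      rw [dist_comm, hmixed t ht s hs htd (not_le.1 hsd), abs_of_nonneg (by linarith)]
    · simp only [if_neg hsd, if_neg htd]
      rw [h₂.2.2 _ ⟨by linarith, by linarith [hs.2]⟩ _ ⟨by linarith, by linarith [ht.2]⟩]
      congr 1
      ring
  · simp [h₁.2.1]

lemma MetricBtw.mem_Icc {x w y : X} (h : MetricBtw x w y) : dist x w ∈ Icc 0 (dist x y) := by
  unfold MetricBtw at h
  exact ⟨dist_nonneg, by linarith [dist_nonneg (x := w) (y := y)]⟩

lemma GeodesicSpace.exists_between (hX : GeodesicSpace X) (x y : X) {s : ℝ}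
    (hs : s ∈ Icc 0 (dist x y)) : ∃ w, MetricBtw x w y ∧ dist x w = s := by
  obtain ⟨f, hf⟩ := hX x y
  exact ⟨f s, hf.metricBtw hs, hf.dist_left_s5 hs⟩

lemma GromovHyperbolic.slimTriangles {δ : ℝ} (hX : GeodesicSpace X)
    (hδ : GromovHyperbolic X δ) : SlimTriangles X δ := by
  intro x y z w hw
  obtain ⟨f, hf, hfw⟩ := hX.exists_through hw
  obtain ⟨g, hg⟩ := hX y z
  obtain ⟨h, hh⟩ := hX x z
  obtain ⟨v, hv, hd⟩ := hδ x y z f g h hf hg hh _ hw.mem_Icc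
  rw [hfw] at hd
  rcases hv with ⟨s, hs, rfl⟩ | ⟨s, hs, rfl⟩
  · exact ⟨_, Or.inl (hg.metricBtw hs), hd⟩
  · exact ⟨_, Or.inr (hh.metricBtw hs), hd⟩

/-- Two geodesics with the same endpoints stay `δ`-close. -/
lemma GromovHyperbolic.exists_near_geodesic {δ : ℝ} (hX : GeodesicSpace X)
    (hδ : GromovHyperbolic X δ) {a b v : X} {f : ℝ → X} (hf : IsGeodesicFrom f a b)
    (hv : MetricBtw a v b) : ∃ z ∈ f '' Icc 0 (dist a b), dist v z ≤ δ := by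
  obtain ⟨h, hh, hhv⟩ := hX.exists_through hv
  obtain ⟨c, hc⟩ := hX b b
  obtain ⟨z, hz, hd⟩ := hδ a b b h c f hh hc hf _ hv.mem_Icc
  rw [hhv] at hd
  refine ⟨z, ?_, hd⟩
  rcases hz with ⟨s, hs, rfl⟩ | hz
  · have hs0 : s = 0 := by simpa using hs
    rw [hs0, hc.1]
    exact ⟨_, ⟨dist_nonneg, le_rfl⟩, hf.2.1⟩
  · exact hz

/-- A nearest point `q` to `p` on a geodesic from `a` to `b` is close to both `[p, a]` and `[p, b]`. -/
lemma GromovHyperbolic.exists_near_of_nearest {δ : ℝ} (h0 : 0 ≤ δ) (hX : GeodesicSpace X)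
    (hδ : GromovHyperbolic X δ) {a b p q : X} {f : ℝ → X} (hf : IsGeodesicFrom f a b)
    (hq : q ∈ f '' Icc 0 (dist a b)) (hmin : ∀ z ∈ f '' Icc 0 (dist a b), dist p q ≤ dist p z)
    {e : X} (he : e = a ∨ e = b) : ∃ v, MetricBtw p v e ∧ dist q v ≤ 3 * δ + 1 := by
  have hslim := hδ.slimTriangles hX
  rcases le_or_gt (dist q p) (2 * δ + 1) with hqp | hqp
  · exact ⟨p, metricBtw_left p e, by linarith⟩
  obtain ⟨w, hw, hqw⟩ := hX.exists_between q p (s := 2 * δ + 1) ⟨by linarith, hqp.le⟩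
  obtain ⟨v, hv | hv, hd⟩ := hslim q p e w hw
  · exact ⟨v, hv, by linarith [dist_triangle q w v]⟩
  exfalso
  obtain ⟨s, hs, rfl⟩ := hq
  have hbtw := hf.metricBtw hs
  have hvab : MetricBtw a v b := by
    rcases he with rfl | rfl
    · exact hv.symm.trans_left hbtw
    · exact (hv.symm.trans_left hbtw.symm).symm
  obtain ⟨z, hz, hvz⟩ := hδ.exists_near_geodesic hX hf hvab
  have h1 := hmin z hz
  unfold MetricBtw at hw
  linarith [dist_triangle4 p w v z, dist_comm p w, dist_comm p (f s)]

end Geodesics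

section Morse

variable {X : Type*} [MetricSpace X]

/-- In a slim space, a segment joining the ends of a chain of at most `2 ^ k` jumps of size at
most `L` is within `δ * k + L` of the chain. -/
lemma SlimTriangles.exists_near_chain {δ L : ℝ} (hX : SlimTriangles X δ) (u : ℕ → X)
    (hu : ∀ i, dist (u i) (u (i + 1)) ≤ L) (k : ℕ) :
    ∀ m n : ℕ, n ≤ 2 ^ k → ∀ z, MetricBtw (u m) z (u (m + n)) →
      ∃ i, dist z (u i) ≤ δ * k + L := by
  induction k with
  | zero =>
    intro m n hn z hz
    refine ⟨m, ?_⟩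
    have hL : dist (u m) (u (m + n)) ≤ L := by
      rcases Nat.le_one_iff_eq_zero_or_eq_one.1 (by simpa using hn) with rfl | rfl
      · simpa using dist_nonneg.trans (hu m)
      · exact hu m
    have := hz.mem_Icc.2
    rw [dist_comm]
    simp only [Nat.cast_zero, mul_zero, zero_add]
    linarith
  | succ k ih =>
    intro m n hn z hz
    rw [pow_succ] at hn
    obtain ⟨n₁, n₂, rfl, h₁, h₂⟩ : ∃ n₁ n₂, n = n₁ + n₂ ∧ n₁ ≤ 2 ^ k ∧ n₂ ≤ 2 ^ k :=
      ⟨n / 2, n - n / 2, by omega, by omega, by omega⟩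
    obtain ⟨v, hv, hd⟩ := hX _ _ (u (m + n₁)) z hz
    have key : ∃ i, dist v (u i) ≤ δ * k + L := by
      rcases hv with hv | hv
      · exact ih (m + n₁) n₂ h₂ v (by rw [add_assoc]; exact hv.symm)
      · exact ih m n₁ h₁ v hv
    obtain ⟨i, hi⟩ := key
    refine ⟨i, ?_⟩
    push_cast
    linarith [dist_triangle z v (u i)]

/-- A segment between two points of a quasigeodesic is logarithmically close to it. -/
lemma SlimTriangles.exists_near_of_abs_sub_le {δ K ε T : ℝ} (hX : SlimTriangles X δ)
    (hK : 0 ≤ K) {c : ℝ → X} (hc : IsQuasigeodesicOn dist K ε (Icc 0 T) c) {s t : ℝ}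
    (hs : s ∈ Icc 0 T) (ht : t ∈ Icc 0 T) {k : ℕ} (hk : |s - t| ≤ 2 ^ k) {z : X}
    (hz : MetricBtw (c s) z (c t)) :
    ∃ τ ∈ Icc 0 T, dist z (c τ) ≤ δ * k + (K + ε) := by
  wlog hst : s ≤ t generalizing s t
  · exact this ht hs (by rwa [abs_sub_comm]) hz.symm (le_of_not_ge hst)
  have hmem : ∀ i : ℕ, min (s + i) t ∈ Icc 0 T := fun i =>
    ⟨le_min (by linarith [hs.1, Nat.cast_nonneg (α := ℝ) i]) ht.1, (min_le_right _ _).trans ht.2⟩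
  have hjump : ∀ i : ℕ, dist (c (min (s + i) t)) (c (min (s + (i + 1 : ℕ)) t)) ≤ K + ε := by
    intro i
    have h1 := (hc _ (hmem i) _ (hmem (i + 1))).2
    have h2 : |min (s + i) t - min (s + (i + 1 : ℕ)) t| ≤ 1 := by
      have := abs_min_sub_min_le_max (s + i) t (s + (i + 1 : ℕ)) t
      refine this.trans ?_
      push_cast
      simp
    nlinarith
  obtain ⟨n, hn⟩ : ∃ n : ℕ, n = ⌈t - s⌉₊ := ⟨_, rfl⟩
  have hn2 : n ≤ 2 ^ k := by
    rw [hn, Nat.ceil_le]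
    rw [abs_sub_comm, abs_of_nonneg (by linarith)] at hk
    exact_mod_cast hk
  have hnt : t - s ≤ n := hn ▸ Nat.le_ceil _
  obtain ⟨i, hi⟩ := hX.exists_near_chain (fun i : ℕ => c (min (s + i) t)) hjump k 0 n hn2 z (by
    simpa [min_eq_left hst, min_eq_right (show t ≤ s + n by linarith)] using hz)
  exact ⟨_, hmem i, hi⟩

lemma exists_forall_mul_add_le_two_pow (A B : ℝ) (hB : 0 ≤ B) :
    ∃ k₀ : ℕ, ∀ k : ℕ, k₀ ≤ k → A * k + B ≤ 2 ^ k := by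
  have hsq : ∀ k : ℕ, 4 ≤ k → k ^ 2 ≤ 2 ^ k := by
    intro k hk
    induction k, hk using Nat.le_induction with
    | base => norm_num
    | succ k hk ih => rw [pow_succ 2]; nlinarith
  refine ⟨⌈A + B⌉₊ + 4, fun k hk => ?_⟩
  have h1 : ((k : ℝ)) ^ 2 ≤ 2 ^ k := by exact_mod_cast hsq k (by omega)
  have h2 : A + B ≤ k := (Nat.le_ceil _).trans (by exact_mod_cast (by omega))
  have h3 : (1 : ℝ) ≤ k := by exact_mod_cast (by omega : 1 ≤ k)
  nlinarith

/-- Linear beats logarithmic growth, in the form used to bound distances to quasigeodesics. -/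
lemma exists_bound_forall_exists_pow {δ : ℝ} (hδ : 0 ≤ δ) {A B : ℝ} (hA : 0 ≤ A) (hB : 0 ≤ B)
    (L : ℝ) : ∃ M : ℝ, 0 ≤ M ∧ ∀ D, M ≤ D → ∃ k : ℕ, A * D + B ≤ 2 ^ k ∧ δ * k + L ≤ D := by
  obtain ⟨k₀, hk₀⟩ := exists_forall_mul_add_le_two_pow (A * (2 * δ + 1)) B hB
  refine ⟨max 0 (2 * (δ * k₀ + δ + L)), le_max_left _ _, fun D hD => ?_⟩
  have hD0 : 0 ≤ D := (le_max_left _ _).trans hD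
  have hDL := (le_max_right _ _).trans hD
  have hpos : 0 < 2 * δ + 1 := by linarith
  have hx : 0 ≤ D / (2 * δ + 1) := by positivity
  have hmul : D / (2 * δ + 1) * (2 * δ + 1) = D := div_mul_cancel₀ _ hpos.ne'
  have hle := Nat.le_ceil (D / (2 * δ + 1))
  have hlt := Nat.ceil_lt_add_one hx
  refine ⟨k₀ + ⌈D / (2 * δ + 1)⌉₊, ?_, ?_⟩
  · refine le_trans ?_ (hk₀ _ (Nat.le_add_right _ _))
    have : D ≤ (2 * δ + 1) * ((k₀ + ⌈D / (2 * δ + 1)⌉₊ : ℕ) : ℝ) := by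
      push_cast
      nlinarith [Nat.cast_nonneg (α := ℝ) k₀]
    nlinarith
  · push_cast
    nlinarith

/-- If the segments joining the ends of a quasigeodesic are `D`-close to it, they are also within
a logarithmic function of `D`. -/
lemma SlimTriangles.exists_near_improve {δ K ε T D : ℝ} (hδ : 0 ≤ δ) (hK : 1 ≤ K) (hε : 0 ≤ ε)
    (hgeo : GeodesicSpace X) (hX : SlimTriangles X δ) (hT : 0 ≤ T) {c : ℝ → X}
    (hc : IsQuasigeodesicOn dist K ε (Icc 0 T) c) (hD : 0 ≤ D)
    (hnear : ∀ z, MetricBtw (c 0) z (c T) → ∃ τ ∈ Icc 0 T, dist z (c τ) ≤ D)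
    {k : ℕ} (hk : 6 * K * D + K * ε ≤ 2 ^ k) {z : X} (hz : MetricBtw (c 0) z (c T)) :
    ∃ τ ∈ Icc 0 T, dist z (c τ) ≤ δ * k + (2 * δ + K + ε) := by
  have hside : ∀ e ∈ Icc 0 T, ∃ w, MetricBtw z w (c e) ∧ dist z w ≤ 2 * D ∧
      (w = c e ∨ dist z w = 2 * D) := by
    intro e he
    rcases le_total (dist z (c e)) (2 * D) with h | h
    · exact ⟨c e, (metricBtw_left _ _).symm, h, Or.inl rfl⟩
    · obtain ⟨w, hw, hzw⟩ := hgeo.exists_between z (c e) (s := 2 * D) ⟨by linarith, h⟩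
      exact ⟨w, hw, hzw.le, Or.inr hzw⟩
  have hpick : ∀ e ∈ Icc 0 T, ∀ w, MetricBtw (c 0) w (c T) → (w = c e ∨ dist z w = 2 * D) →
      ∃ s ∈ Icc 0 T, dist w (c s) ≤ D ∧ (w = c s ∨ dist z w = 2 * D) := by
    rintro e he w hw (rfl | h)
    · exact ⟨e, he, by simpa using hD, Or.inl rfl⟩
    · obtain ⟨s, hs, hd⟩ := hnear w hw
      exact ⟨s, hs, hd, Or.inr h⟩
  have hend : ∀ s ∈ Icc 0 T, ∀ w v, dist w (c s) ≤ D → (w = c s ∨ dist z w = 2 * D) →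
      MetricBtw w v (c s) → dist z v ≤ 2 * δ →
      ∃ τ ∈ Icc 0 T, dist z (c τ) ≤ δ * k + (2 * δ + K + ε) := by
    intro s hs w v hws hor hv hzv
    have hk0 : 0 ≤ δ * k := by positivity
    rcases hor with rfl | h
    · have hv0 := hv.mem_Icc.2
      rw [dist_self] at hv0
      exact ⟨s, hs, by linarith [dist_triangle z v (c s), dist_comm v (c s)]⟩
    · obtain ⟨τ, hτ, hd⟩ := hnear z hz
      exact ⟨τ, hτ, by linarith [hv.mem_Icc.2, dist_triangle z v w, dist_comm v w]⟩
  have h0 : (0 : ℝ) ∈ Icc 0 T := ⟨le_rfl, hT⟩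
  have hTT : T ∈ Icc 0 T := ⟨hT, le_rfl⟩
  obtain ⟨w, hw, hzw, hwor⟩ := hside 0 h0
  obtain ⟨w', hw', hzw', hwor'⟩ := hside T hTT
  obtain ⟨s, hs, hws, hsor⟩ := hpick 0 h0 w (hw.symm.trans_left hz) hwor
  obtain ⟨t, ht, hwt, htor⟩ := hpick T hTT w' (hw'.symm.trans_left hz.symm).symm hwor'
  have hst : |s - t| ≤ 2 ^ k := by
    have h1 := (hc s hs t ht).1
    have h2 : dist (c s) (c t) ≤ 6 * D := by
      linarith [dist_triangle4 (c s) w w' (c t), dist_triangle w z w', dist_comm w z,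
        dist_comm w (c s)]
    have h3 : |s - t| = K * (1 / K * |s - t|) := by field_simp
    have h4 : K * (1 / K * |s - t|) ≤ K * (6 * D + ε) :=
      mul_le_mul_of_nonneg_left (by linarith) (by linarith)
    linarith
  obtain ⟨v, hv | hv, hzv⟩ := hX w w' (c t) z (hz.inner hw.symm hw')
  · exact hend t ht w' v hwt htor hv (by linarith)
  obtain ⟨v', hv' | hv', hvv'⟩ := hX w (c t) (c s) v hv
  · obtain ⟨τ, hτ, hd⟩ := hX.exists_near_of_abs_sub_le (by linarith) hc hs ht hst hv'.symm
    exact ⟨τ, hτ, by linarith [dist_triangle4 z v v' (c τ)]⟩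
  · exact hend s hs w v' hws hsor hv' (by linarith [dist_triangle z v v'])

/-- Segments joining the ends of a quasigeodesic are uniformly close to it. -/
lemma exists_segment_near_quasigeodesic {δ K ε : ℝ} (hδ : 0 ≤ δ) (hK : 1 ≤ K) (hε : 0 ≤ ε) :
    ∃ M : ℝ, 0 ≤ M ∧ ∀ (X : Type*) [MetricSpace X], GeodesicSpace X → SlimTriangles X δ →
      ∀ (T : ℝ) (c : ℝ → X), 0 ≤ T → IsQuasigeodesicOn dist K ε (Icc 0 T) c →
        ∀ z, MetricBtw (c 0) z (c T) → ∃ τ ∈ Icc 0 T, dist z (c τ) ≤ M := by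
  obtain ⟨M, hM, hbound⟩ := exists_bound_forall_exists_pow hδ (A := 6 * K) (B := K * ε)
    (by linarith) (by positivity) (2 * δ + K + ε + 1)
  refine ⟨M, hM, fun X _ hgeo hX T c hT hc => ?_⟩
  have hdescent : ∀ n : ℕ,
      (∀ z, MetricBtw (c 0) z (c T) → ∃ τ ∈ Icc 0 T, dist z (c τ) ≤ M + n) →
      ∀ z, MetricBtw (c 0) z (c T) → ∃ τ ∈ Icc 0 T, dist z (c τ) ≤ M := by
    intro n
    induction n with
    | zero => simp
    | succ n ih =>
      intro h
      refine ih fun z hz => ?_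
      have hn : (0 : ℝ) ≤ (n + 1 : ℕ) := Nat.cast_nonneg _
      obtain ⟨k, hk, hkD⟩ := hbound (M + (n + 1 : ℕ)) (by linarith)
      obtain ⟨τ, hτ, hd⟩ := hX.exists_near_improve hδ hK hε hgeo hT hc (by linarith) h hk hz
      push_cast at hkD
      exact ⟨τ, hτ, by linarith⟩
  refine hdescent ⌈dist (c 0) (c T)⌉₊ fun z hz => ⟨0, ⟨le_rfl, hT⟩, ?_⟩
  rw [dist_comm]
  linarith [hz.mem_Icc.2, Nat.le_ceil (dist (c 0) (c T))]

/-- The Morse lemma: a quasigeodesic is uniformly close to the segments joining its ends. -/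
lemma exists_quasigeodesic_near_segment {δ K ε : ℝ} (hδ : 0 ≤ δ) (hK : 1 ≤ K) (hε : 0 ≤ ε) :
    ∃ R : ℝ, 0 ≤ R ∧ ∀ (X : Type*) [MetricSpace X], GeodesicSpace X → SlimTriangles X δ →
      ∀ (T : ℝ) (c : ℝ → X), IsQuasigeodesicOn dist K ε (Icc 0 T) c →
        ∀ t ∈ Icc 0 T, ∃ z, MetricBtw (c 0) z (c T) ∧ dist (c t) z ≤ R := by
  obtain ⟨M, hM, hnear⟩ := exists_segment_near_quasigeodesic hδ hK hε
  refine ⟨K * (K * (2 * M + 1 + ε)) + ε + M, by positivity, fun X _ hgeo hX T c hc t ht => ?_⟩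
  have hT : 0 ≤ T := ht.1.trans ht.2
  have hnear := hnear X hgeo hX T c hT hc
  obtain ⟨g, hg⟩ := hgeo (c 0) (c T)
  have hmem : ∀ n : ℕ, min (n : ℝ) (dist (c 0) (c T)) ∈ Icc 0 (dist (c 0) (c T)) := fun n =>
    ⟨le_min (Nat.cast_nonneg _) dist_nonneg, min_le_right _ _⟩
  have hclose : ∀ s ∈ Icc 0 T, ∀ s' ∈ Icc 0 T, s ≤ t → t ≤ s' → ∀ z, MetricBtw (c 0) z (c T) →
      dist z (c s) ≤ M → dist z (c s') ≤ M + 1 →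
      ∃ z, MetricBtw (c 0) z (c T) ∧ dist (c t) z ≤ K * (K * (2 * M + 1 + ε)) + ε + M := by
    intro s hs s' hs' hst hts' z hz hzs hzs'
    refine ⟨z, hz, ?_⟩
    have h1 := (hc s hs s' hs').1
    have h2 := (hc t ht s hs).2
    rw [abs_sub_comm, abs_of_nonneg (by linarith)] at h1
    rw [abs_of_nonneg (by linarith)] at h2
    have h3 : s' - s = K * (1 / K * (s' - s)) := by field_simp
    have h4 : K * (1 / K * (s' - s)) ≤ K * (2 * M + 1 + ε) :=
      mul_le_mul_of_nonneg_left
        (by linarith [dist_triangle (c s) z (c s'), dist_comm z (c s)]) (by linarith)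
    have h5 : K * (t - s) ≤ K * (K * (2 * M + 1 + ε)) :=
      mul_le_mul_of_nonneg_left (by linarith) (by linarith)
    linarith [dist_triangle (c t) (c s) z, dist_comm z (c s)]
  by_cases hall : ∀ n : ℕ, ∃ s ∈ Icc 0 T, s ≤ t ∧
      dist (g (min (n : ℝ) (dist (c 0) (c T)))) (c s) ≤ M
  · obtain ⟨s, hs, hst, hd⟩ := hall ⌈dist (c 0) (c T)⌉₊
    rw [min_eq_right (Nat.le_ceil _), hg.2.1] at hd
    refine hclose s hs T ⟨hT, le_rfl⟩ hst ht.2 (c T) (metricBtw_left _ _).symm hd ?_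
    simp only [dist_self]
    linarith
  · have hstep : ∃ n : ℕ, (∃ s ∈ Icc 0 T, s ≤ t ∧
        dist (g (min (n : ℝ) (dist (c 0) (c T)))) (c s) ≤ M) ∧
        ¬ ∃ s ∈ Icc 0 T, s ≤ t ∧
          dist (g (min ((n + 1 : ℕ) : ℝ) (dist (c 0) (c T)))) (c s) ≤ M := by
      by_contra! hcon
      refine hall fun n => ?_
      induction n with
      | zero =>
        refine ⟨0, ⟨le_rfl, hT⟩, ht.1, ?_⟩
        simpa [hg.1] using hM
      | succ n ih => exact hcon n ih
    obtain ⟨n, ⟨s, hs, hst, hd⟩, hnot⟩ := hstep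
    obtain ⟨s', hs', hd'⟩ := hnear _ (hg.metricBtw (hmem (n + 1)))
    have hts' : t ≤ s' := by
      by_contra! hlt
      exact hnot ⟨s', hs', hlt.le, hd'⟩
    refine hclose s hs s' hs' hst hts' _ (hg.metricBtw (hmem n)) hd ?_
    have h1 := hg.2.2 _ (hmem n) _ (hmem (n + 1))
    have h2 : |min (n : ℝ) (dist (c 0) (c T)) - min ((n + 1 : ℕ) : ℝ) (dist (c 0) (c T))| ≤ 1 := by
      refine (abs_min_sub_min_le_max _ _ _ _).trans ?_
      push_cast
      simp
    linarith [dist_triangle (g (min (n : ℝ) (dist (c 0) (c T))))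
      (g (min ((n + 1 : ℕ) : ℝ) (dist (c 0) (c T)))) (c s')]

/-- Quasi-isometric embeddings coarsely preserve betweenness. -/
lemma exists_metricBtw_near_image {δ K ε : ℝ} (hδ : 0 ≤ δ) (hK : 1 ≤ K) (hε : 0 ≤ ε) :
    ∃ R : ℝ, 0 ≤ R ∧ ∀ (Y₁ : Type*) [MetricSpace Y₁] (Y₂ : Type*) [MetricSpace Y₂],
      GeodesicSpace Y₁ → GeodesicSpace Y₂ → SlimTriangles Y₂ δ →
      ∀ φ : Y₁ → Y₂, IsQIEmbedding K ε φ → ∀ x w y : Y₁, MetricBtw x w y →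
        ∃ z, MetricBtw (φ x) z (φ y) ∧ dist (φ w) z ≤ R := by
  obtain ⟨R, hR, h⟩ := exists_quasigeodesic_near_segment hδ hK hε
  refine ⟨R, hR, fun Y₁ _ Y₂ _ hg₁ hg₂ hslim φ hφ x w y hw => ?_⟩
  obtain ⟨f, hf, hfw⟩ := hg₁.exists_through hw
  obtain ⟨z, hz, hd⟩ := h Y₂ hg₂ hslim (dist x y) (φ ∘ f) (fun s hs t ht => by
    rw [← hf.2.2 s hs t ht]
    exact hφ (f s) (f t)) _ hw.mem_Icc
  simp only [Function.comp_apply, hf.1, hf.2.1, hfw] at hz hd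
  exact ⟨z, hz, hd⟩

end Morse

/-- Two points that are almost between each pair of vertices of a triangle are at almost the same
distance from each vertex. -/
lemma abs_dist_sub_dist_le_of_almost_between {X : Type*} [MetricSpace X] {a b p x y : X} {E : ℝ}
    (hxab : dist a x + dist x b ≤ dist a b + E) (hxpa : dist p x + dist x a ≤ dist p a + E)
    (hxpb : dist p x + dist x b ≤ dist p b + E) (hyab : dist a y + dist y b ≤ dist a b + E)
    (hypa : dist p y + dist y a ≤ dist p a + E) (hypb : dist p y + dist y b ≤ dist p b + E) :
    |dist a x - dist a y| ≤ 3 / 2 * E := by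
  rw [abs_le]
  constructor <;>
    linarith [dist_triangle a x b, dist_triangle p x a, dist_triangle p x b, dist_triangle a y b,
      dist_triangle p y a, dist_triangle p y b, dist_comm x a, dist_comm y a]

/-- Quasi-isometries and nearest-point projections almost commute:
for `δ`-hyperbolic geodesic spaces `Y₁, Y₂`, a geodesic `μ₁` in `Y₁` from `a` to `b`,
a point `p ∈ Y₁`, a nearest point `q` of `μ₁` to `p`, a `(K,ε)`-quasi-isometric embedding
`φ : Y₁ → Y₂`, a geodesic `μ₂` in `Y₂` from `φ a` to `φ b` and a nearest point `r` of `μ₂`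
to `φ p`, one has `d₂(r, φ q) ≤ C₄` with `C₄` depending only on `K`, `ε` and `δ`. -/
theorem projections_almost_commute_with_qi :
    ∀ δ K ε : ℝ, 0 ≤ δ → 1 ≤ K → 0 ≤ ε →
      ∃ C₄ : ℝ, 0 ≤ C₄ ∧
        ∀ (Y₁ : Type) [MetricSpace Y₁] (Y₂ : Type) [MetricSpace Y₂],
          GeodesicSpace Y₁ → GromovHyperbolic Y₁ δ →
          GeodesicSpace Y₂ → GromovHyperbolic Y₂ δ →
          ∀ a b p : Y₁, ∀ f : ℝ → Y₁, IsGeodesicFrom f a b →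
            ∀ q ∈ f '' Set.Icc (0 : ℝ) (dist a b),
              (∀ z ∈ f '' Set.Icc (0 : ℝ) (dist a b), dist p q ≤ dist p z) →
              ∀ φ : Y₁ → Y₂, IsQIEmbedding K ε φ →
                ∀ g : ℝ → Y₂, IsGeodesicFrom g (φ a) (φ b) →
                  ∀ r ∈ g '' Set.Icc (0 : ℝ) (dist (φ a) (φ b)),
                    (∀ z ∈ g '' Set.Icc (0 : ℝ) (dist (φ a) (φ b)),
                      dist (φ p) r ≤ dist (φ p) z) →
                    dist r (φ q) ≤ C₄ := by
  intro δ K ε hδ hK hε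
  obtain ⟨R, hR, hmorse⟩ := exists_metricBtw_near_image hδ hK hε
  have hP : 0 ≤ K * (3 * δ + 1) + ε := by positivity
  refine ⟨3 * (R + (K * (3 * δ + 1) + ε) + (3 * δ + 1)) + 2 * (R + δ), by positivity, ?_⟩
  intro Y₁ _ Y₂ _ hg₁ hh₁ hg₂ hh₂ a b p f hf q hq hqmin φ hφ g hg r hr hrmin
  have hmorse := hmorse Y₁ Y₂ hg₁ hg₂ (hh₂.slimTriangles hg₂) φ hφ
  have hside : ∀ e, e = a ∨ e = b → dist (φ p) (φ q) + dist (φ q) (φ e) ≤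
      dist (φ p) (φ e) + 2 * (R + (K * (3 * δ + 1) + ε) + (3 * δ + 1)) := by
    intro e he
    obtain ⟨v, hv, hqv⟩ := hh₁.exists_near_of_nearest hδ hg₁ hf hq hqmin he
    obtain ⟨z, hz, hvz⟩ := hmorse p v e hv
    have h1 := (hφ q v).2
    have h2 : K * dist q v ≤ K * (3 * δ + 1) := mul_le_mul_of_nonneg_left hqv (by linarith)
    exact hz.dist_add_dist_le (by linarith [dist_triangle (φ q) (φ v) z])
  have hside' : ∀ e, e = φ a ∨ e = φ b → dist (φ p) r + dist r e ≤
      dist (φ p) e + 2 * (R + (K * (3 * δ + 1) + ε) + (3 * δ + 1)) := by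
    intro e he
    obtain ⟨v, hv, hrv⟩ := hh₂.exists_near_of_nearest hδ hg₂ hg hr hrmin he
    exact hv.dist_add_dist_le (by linarith)
  obtain ⟨s, hs, rfl⟩ := hq
  obtain ⟨t, ht, rfl⟩ := hr
  obtain ⟨z, hz, hqz⟩ := hmorse a (f s) b (hf.metricBtw hs)
  obtain ⟨_, ⟨τ, hτ, rfl⟩, hzτ⟩ := hh₂.exists_near_geodesic hg₂ hg hz
  have hcenter := abs_dist_sub_dist_le_of_almost_between
    (hz.dist_add_dist_le (hqz.trans (by linarith))) (hside a (Or.inl rfl)) (hside b (Or.inr rfl))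
    ((hg.metricBtw ht).dist_add_dist_le ((dist_self _).trans_le (by linarith)))
    (hside' _ (Or.inl rfl)) (hside' _ (Or.inr rfl))
  have hqτ : dist (φ (f s)) (g τ) ≤ R + δ := by
    linarith [dist_triangle (φ (f s)) z (g τ)]
  have hrτ : dist (g t) (g τ) ≤
      3 * (R + (K * (3 * δ + 1) + ε) + (3 * δ + 1)) + (R + δ) := by
    rw [hg.2.2 t ht τ hτ]
    rw [hg.dist_left_s5 ht] at hcenter
    have h1 := hg.dist_left_s5 hτ
    have h2 := dist_triangle (φ a) (φ (f s)) (g τ)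
    have h3 := dist_triangle (φ a) (g τ) (φ (f s))
    rw [dist_comm (g τ)] at h3
    rw [abs_le] at hcenter ⊢
    constructor <;> linarith [hcenter.1, hcenter.2]
  linarith [dist_triangle (g t) (g τ) (φ (f s)), dist_comm (g τ) (φ (f s))]
end
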